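/- (Lemma 2) Let A be a random M×N matrix over F_q whose M·N entries are i.i.d. with distribution μ, where M ≥ N ≥ 1. Then the probability that rank(A) < N is at least η_min(N,M) = 1 − Π_{i=1}^{N} (1 − β_min^{M−i+1}), where β_min = min(ε_SR, (1−ε_SR)/(q−1)). -/

import Mathlib

open Finset
open scoped Classical

noncomputable section

/-- The entry distribution μ on the finite field `F`: the value `0` has
probability `ε_SR` and each nonzero value has probability `(1-ε_SR)/(q-1)`,
where `q = |F|`. -/
def muDist (F : Type*) [Field F] [Fintype F] [DecidableEq F] (εSR : ℝ) (t : F) : ℝ :=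
  if t = 0 then εSR else (1 - εSR) / ((Fintype.card F : ℝ) - 1)

/-- The probability that a random `M × N` matrix over `F` with i.i.d.
`μ`-distributed entries equals the fixed matrix `A`. -/
def matProb (F : Type*) [Field F] [Fintype F] [DecidableEq F] (εSR : ℝ) {M N : ℕ}
    (A : Matrix (Fin M) (Fin N) F) : ℝ :=
  ∏ i, ∏ j, muDist F εSR (A i j)

/-- Every vector can be moved into `V` by changing at most `card ι - finrank V` fixed coordinates. -/
theorem Submodule.exists_finset_card_eq_forall_exists_mem_eq_off {F ι : Type*} [Field F]
    [Fintype ι] (V : Submodule F (ι → F)) :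
    ∃ T : Finset ι, T.card = Fintype.card ι - Module.finrank F V ∧
      ∀ y : ι → F, ∃ x ∈ V, ∀ i ∉ T, x i = y i := by
  obtain ⟨κ, a, ha, hspan, hli⟩ := exists_linearIndependent' F
    (fun i : ι => V.mkQ (Pi.single i (1 : F)))
  have : Finite κ := Finite.of_injective a ha
  have : Fintype κ := Fintype.ofFinite κ
  have htop : Submodule.span F (Set.range (fun i : ι => V.mkQ (Pi.single i (1 : F)))) = ⊤ := by
    have h := (Pi.basisFun F ι).span_eq
    have h2 := congrArg (Submodule.map V.mkQ) h
    rw [Submodule.map_span, Submodule.map_top, Submodule.range_mkQ, ← Set.range_comp] at h2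
    rw [← h2]
    congr 2
  rw [htop] at hspan
  refine ⟨univ.image a, ?_, fun y => ?_⟩
  · rw [card_image_of_injective _ ha, card_univ, ← finrank_span_eq_card hli, hspan, finrank_top,
      Submodule.finrank_quotient, Module.finrank_fintype_fun_eq_card]
  · have hy : V.mkQ y ∈ Submodule.span F
        (Set.range ((fun i : ι => V.mkQ (Pi.single i (1 : F))) ∘ a)) := by
      rw [hspan]; trivial
    obtain ⟨c, hc⟩ := (Submodule.mem_span_range_iff_exists_fun F).1 hy
    refine ⟨y - ∑ k, c k • Pi.single (a k) (1 : F), ?_, fun i hi => ?_⟩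
    · rw [← Submodule.Quotient.mk_eq_zero, ← Submodule.mkQ_apply, map_sub, map_sum, sub_eq_zero,
        ← hc]
      simp
    · have h0 : ∀ k, (Pi.single (a k) (1 : F) : ι → F) i = 0 := fun k =>
        Pi.single_eq_of_ne (fun h => hi (by simp [h])) _
      simp [h0]

/-- A vector with i.i.d. coordinates, each value having mass at least `β`, lies in a subspace of
codimension `c` with probability at least `β ^ c`. -/
theorem pow_le_sum_prod_of_mem_submodule {F ι : Type*} [Field F] [Fintype F] [Fintype ι]
    (m : F → ℝ) {β : ℝ} (hβ : 0 ≤ β) (hm : ∀ t, β ≤ m t) (hsum : ∑ t, m t = 1)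
    (V : Submodule F (ι → F)) :
    β ^ (Fintype.card ι - Module.finrank F V) ≤
      ∑ x : ι → F, if x ∈ V then ∏ i, m (x i) else 0 := by
  obtain ⟨T, hT, hex⟩ := V.exists_finset_card_eq_forall_exists_mem_eq_off
  have hex' : ∀ z : {i // i ∉ T} → F, ∃ x ∈ V, ∀ i : {i // i ∉ T}, x i = z i := fun z => by
    obtain ⟨x, hx, h⟩ := hex (fun i => if h : i ∉ T then z ⟨i, h⟩ else 0)
    exact ⟨x, hx, fun i => by rw [h i i.2, dif_pos i.2]⟩
  choose s hsV hs using hex'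
  have hinj : Function.Injective s := fun z w h => by
    ext i
    rw [← hs z i, ← hs w i, h]
  have hm0 : ∀ t, 0 ≤ m t := fun t => hβ.trans (hm t)
  rw [← hT]
  calc β ^ T.card = ∑ z : {i // i ∉ T} → F, β ^ T.card * ∏ i, m (z i) := by
        rw [← mul_sum, ← Fintype.prod_sum fun (_ : {i // i ∉ T}) t => m t]
        simp [hsum]
    _ ≤ ∑ z, ∏ i, m (s z i) := by
        refine sum_le_sum fun z _ => ?_
        rw [← Fintype.prod_subtype_mul_prod_subtype (fun i => i ∈ T) fun i => m (s z i)]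
        simp only [hs]
        refine mul_le_mul_of_nonneg_right ?_ (prod_nonneg fun i _ => hm0 _)
        refine le_trans (le_of_eq ?_)
          (prod_le_prod (f := fun _ => β) (fun _ _ => hβ) fun i _ => hm _)
        simp
    _ = ∑ x ∈ univ.image s, ∏ i, m (x i) :=
      (sum_image (f := fun x : ι → F => ∏ i, m (x i)) hinj.injOn).symm
    _ ≤ ∑ x ∈ univ.filter (· ∈ V), ∏ i, m (x i) := by
        refine sum_le_sum_of_subset_of_nonneg ?_ fun x _ _ => prod_nonneg fun i _ => hm0 _
        intro x hx
        obtain ⟨z, -, rfl⟩ := mem_image.1 hx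
        simp [hsV z]
    _ = _ := sum_filter _ _

/-- Independent random vectors with i.i.d. coordinates of mass at least `β` at each value are
linearly independent with probability at most `∏ k < N, (1 - β ^ (card ι - k))`. -/
theorem sum_linearIndependent_le {F ι : Type*} [Field F] [Fintype F] [Fintype ι]
    (m : F → ℝ) {β : ℝ} (hβ : 0 ≤ β) (hβ1 : β ≤ 1) (hm : ∀ t, β ≤ m t) (hsum : ∑ t, m t = 1)
    (N : ℕ) :
    (∑ v : Fin N → ι → F, if LinearIndependent F v then ∏ k, ∏ i, m (v k i) else 0) ≤
      ∏ k ∈ range N, (1 - β ^ (Fintype.card ι - k)) := by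
  have hm0 : ∀ t, 0 ≤ m t := fun t => hβ.trans (hm t)
  induction N with
  | zero => simp
  | succ N ih =>
    have hc : 0 ≤ 1 - β ^ (Fintype.card ι - N) := sub_nonneg.2 (pow_le_one₀ hβ hβ1)
    rw [prod_range_succ]
    refine le_trans ?_ (mul_le_mul_of_nonneg_right ih hc)
    rw [← (Fin.consEquiv fun _ : Fin (N + 1) => ι → F).sum_comp, Fintype.sum_prod_type_right,
      sum_mul]
    refine sum_le_sum fun v _ => ?_
    have hcons : ∀ x, LinearIndependent F ((Fin.consEquiv fun _ : Fin (N + 1) => ι → F) (x, v)) ↔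
        LinearIndependent F v ∧ x ∉ Submodule.span F (Set.range v) :=
      fun x => linearIndependent_finCons
    simp only [hcons, Fin.consEquiv_apply, Fin.prod_univ_succ, Fin.cons_zero, Fin.cons_succ]
    by_cases hv : LinearIndependent F v
    · have hV := pow_le_sum_prod_of_mem_submodule m hβ hm hsum (Submodule.span F (Set.range v))
      rw [finrank_span_eq_card hv, Fintype.card_fin] at hV
      have htot : ∑ x : ι → F, ∏ i, m (x i) = 1 := by
        rw [← Fintype.prod_sum fun (_ : ι) t => m t]
        simp [hsum]
      have hsplit : (∑ x : ι → F, if x ∉ Submodule.span F (Set.range v) then ∏ i, m (x i) else 0) =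
          1 - ∑ x : ι → F, if x ∈ Submodule.span F (Set.range v) then ∏ i, m (x i) else 0 := by
        rw [← htot, ← sum_sub_distrib]
        refine sum_congr rfl fun x _ => ?_
        by_cases hx : x ∈ Submodule.span F (Set.range v) <;> simp [hx]
      simp only [hv, true_and, if_true]
      calc _ = (∏ k, ∏ i, m (v k i)) *
            ∑ x : ι → F, if x ∉ Submodule.span F (Set.range v) then ∏ i, m (x i) else 0 := by
            rw [mul_sum]
            refine sum_congr rfl fun x _ => ?_
            split_ifs <;> ring
        _ ≤ _ := by
            refine mul_le_mul_of_nonneg_left ?_ (prod_nonneg fun k _ => prod_nonneg fun i _ => hm0 _)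
            rw [hsplit]
            linarith
    · simp [hv]

/-- The entry distribution has total mass one. -/
theorem sum_muDist (F : Type*) [Field F] [Fintype F] [DecidableEq F] (εSR : ℝ) :
    ∑ t : F, muDist F εSR t = 1 := by
  have hq : (1 : ℝ) < Fintype.card F := by exact_mod_cast Fintype.one_lt_card
  have hne : (Fintype.card F : ℝ) - 1 ≠ 0 := by linarith
  have hmu : ∀ t ∈ univ.erase (0 : F),
      muDist F εSR t = (1 - εSR) / ((Fintype.card F : ℝ) - 1) :=
    fun t ht => if_neg (ne_of_mem_erase ht)
  rw [← add_sum_erase _ _ (mem_univ (0 : F)), sum_congr rfl hmu, sum_const, card_erase_of_mem (mem_univ _), card_univ,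
    nsmul_eq_mul, Nat.cast_sub Fintype.card_pos, Nat.cast_one, mul_div_cancel₀ _ hne]
  simp [muDist]

/-- Lemma 2: for a random `M × N` matrix `A` over `F_q` with i.i.d.
`μ`-distributed entries, where `M ≥ N ≥ 1`, the probability that `rank(A) < N`
is at least `η_min(N,M) = 1 − Π_{i=1}^{N} (1 − β_min^{M−i+1})`, where
`β_min = min(ε_SR, (1−ε_SR)/(q−1))`. -/
theorem stmt_12 (F : Type*) [Field F] [Fintype F] [DecidableEq F]
    (hq : 2 ≤ Fintype.card F)
    (εSR : ℝ) (hεSR : εSR ∈ Set.Icc (0 : ℝ) 1)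
    (M N : ℕ) (hN : 1 ≤ N) (hMN : N ≤ M) :
    1 - ∏ i ∈ Icc 1 N,
        (1 - (min εSR ((1 - εSR) / ((Fintype.card F : ℝ) - 1))) ^ (M - i + 1)) ≤
      (∑ A : Matrix (Fin M) (Fin N) F,
        if A.rank < N then matProb F εSR A else 0) := by
  set β : ℝ := min εSR ((1 - εSR) / ((Fintype.card F : ℝ) - 1)) with hβdef
  have hq' : (2 : ℝ) ≤ Fintype.card F := by exact_mod_cast hq
  have hβ : 0 ≤ β := le_min hεSR.1 (div_nonneg (by linarith [hεSR.2]) (by linarith))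
  have hβ1 : β ≤ 1 := (min_le_left _ _).trans hεSR.2
  have hm : ∀ t, β ≤ muDist F εSR t := fun t => by
    unfold muDist
    split_ifs
    exacts [min_le_left _ _, min_le_right _ _]
  have hsum := sum_muDist F εSR
  have hprod : ∏ i ∈ Icc 1 N, (1 - β ^ (M - i + 1)) = ∏ k ∈ range N, (1 - β ^ (M - k)) := by
    rw [← Finset.Ico_add_one_right_eq_Icc, prod_Ico_eq_prod_range]
    refine prod_congr (by simp) fun k hk => ?_
    have : k < N := by simpa using hk
    congr 2
    omega
  have htot : ∑ A : Matrix (Fin M) (Fin N) F, matProb F εSR A = 1 := by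
    have hrow : ∑ x : Fin N → F, ∏ j, muDist F εSR (x j) = 1 := by
      rw [← Fintype.prod_sum fun (_ : Fin N) t => muDist F εSR t]
      simp [hsum]
    unfold matProb
    refine (Fintype.prod_sum fun (_ : Fin M) (x : Fin N → F) =>
      ∏ j, muDist F εSR (x j)).symm.trans ?_
    simp [hrow]
  have hrank : ∀ A : Matrix (Fin M) (Fin N) F, A.rank < N ↔ ¬ LinearIndependent F A.col := by
    intro A
    have hle : A.rank ≤ N := A.rank_le_width
    rw [linearIndependent_iff_card_eq_finrank_span, Fintype.card_fin, Set.finrank,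
      ← Matrix.rank_eq_finrank_span_cols]
    omega
  have hfull : (∑ A : Matrix (Fin M) (Fin N) F,
      if LinearIndependent F A.col then matProb F εSR A else 0) =
      ∑ v : Fin N → Fin M → F,
        if LinearIndependent F v then ∏ k, ∏ i, muDist F εSR (v k i) else 0 := by
    refine Fintype.sum_equiv (Equiv.piComm fun _ _ => F) _ _ fun A => ?_
    have hA : matProb F εSR A = ∏ k, ∏ i, muDist F εSR (A i k) := prod_comm
    rw [hA]
    rfl
  have hbound : (∑ v : Fin N → Fin M → F,
      if LinearIndependent F v then ∏ k, ∏ i, muDist F εSR (v k i) else 0) ≤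
      ∏ k ∈ range N, (1 - β ^ (M - k)) := by
    convert sum_linearIndependent_le (ι := Fin M) (muDist F εSR) hβ hβ1 hm hsum N
    exact (Fintype.card_fin M).symm
  rw [← hprod, ← hfull] at hbound
  have hsplit : (∑ A : Matrix (Fin M) (Fin N) F, if A.rank < N then matProb F εSR A else 0) =
      1 - ∑ A : Matrix (Fin M) (Fin N) F,
        if LinearIndependent F A.col then matProb F εSR A else 0 := by
    rw [← htot, ← sum_sub_distrib]
    refine sum_congr rfl fun A _ => ?_
    by_cases hA : LinearIndependent F A.col <;> simp [hrank, hA]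
  rw [hsplit]
  linarith
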